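/- For every positive integer k, let Γ₁ be the group with presentation ⟨a, b, c | [b, a] = c^k, [c, a] = 1, [c, b] = 1⟩ (where [x, y] = x·y·x⁻¹·y⁻¹). Then there exists an injective group homomorphism φ : Γ₁ → GL(3, ℂ) with φ(a) = ψ(2k, 0), φ(b) = ψ(2ki, 0), and φ(c) = ψ(0, 16k); moreover all matrix entries of φ(a), φ(b), φ(c) lie in the ring of Gaussian integers ℤ[i]. -/

import Mathlib

open Matrix Complex

/-- The matrix `ψ(ξ, t)` realizing the Heisenberg group element `(ξ, t)` in `GL(3, ℂ)`. -/
noncomputable def heisenbergPsi (ξ : ℂ) (t : ℝ) : Matrix (Fin 3) (Fin 3) ℂ :=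
  !![1, ξ, ξ;
     -(starRingEnd ℂ ξ), 1 - ((normSq ξ : ℂ) - t * I) / 2, -(((normSq ξ : ℂ) - t * I) / 2);
     starRingEnd ℂ ξ, ((normSq ξ : ℂ) - t * I) / 2, 1 + ((normSq ξ : ℂ) - t * I) / 2]

/-- The relator set for `Γ₁ = ⟨a, b, c | [b,a] = c^k, [c,a] = 1, [c,b] = 1⟩`,
with generators `a = 0`, `b = 1`, `c = 2`. -/
def gamma1Rels (k : ℕ) : Set (FreeGroup (Fin 3)) :=
  { FreeGroup.of 1 * FreeGroup.of 0 * (FreeGroup.of 1)⁻¹ * (FreeGroup.of 0)⁻¹ *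
      ((FreeGroup.of 2) ^ k)⁻¹,
    FreeGroup.of 2 * FreeGroup.of 0 * (FreeGroup.of 2)⁻¹ * (FreeGroup.of 0)⁻¹,
    FreeGroup.of 2 * FreeGroup.of 1 * (FreeGroup.of 2)⁻¹ * (FreeGroup.of 1)⁻¹ }

theorem heisenbergPsi_mul (ξ η : ℂ) (t s : ℝ) :
    heisenbergPsi ξ t * heisenbergPsi η s =
      heisenbergPsi (ξ + η) (t + s + 2 * (ξ * starRingEnd ℂ η).im) := by
  have key : (2 * (ξ * starRingEnd ℂ η).im : ℂ) * I =
      ξ * starRingEnd ℂ η - starRingEnd ℂ ξ * η := by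
    apply Complex.ext <;> simp; ring
  have hξ := Complex.mul_conj ξ
  have hη := Complex.mul_conj η
  have hs : ((normSq (ξ + η) : ℝ) : ℂ) =
      normSq ξ + normSq η + ξ * starRingEnd ℂ η + starRingEnd ℂ ξ * η := by
    rw [← Complex.mul_conj, ← hξ, ← hη, map_add]
    ring
  ext i j
  fin_cases i <;> fin_cases j <;>
    simp only [heisenbergPsi, Matrix.mul_apply, Fin.sum_univ_three, Matrix.of_apply,
      Matrix.cons_val, Fin.zero_eta, Fin.mk_one, Fin.reduceFinMk, hs, map_add, ofReal_add,
      ofReal_mul, ofReal_ofNat, add_mul _ _ I, key] <;>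
    ring

theorem heisenbergPsi_zero : heisenbergPsi 0 0 = 1 := by
  ext i j
  fin_cases i <;> fin_cases j <;> simp [heisenbergPsi]

/-- The matrix `ψ(ξ, t)` as an element of `GL(3, ℂ)`. -/
noncomputable def heisenbergGL (ξ : ℂ) (t : ℝ) : GL (Fin 3) ℂ where
  val := heisenbergPsi ξ t
  inv := heisenbergPsi (-ξ) (-t)
  val_inv := by
    rw [heisenbergPsi_mul, ← heisenbergPsi_zero]
    congr 1 <;> simp [Complex.mul_conj]
  inv_val := by
    rw [heisenbergPsi_mul, ← heisenbergPsi_zero]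
    congr 1 <;> simp [Complex.mul_conj]

theorem coe_heisenbergGL (ξ : ℂ) (t : ℝ) :
    (heisenbergGL ξ t : Matrix (Fin 3) (Fin 3) ℂ) = heisenbergPsi ξ t :=
  rfl

theorem heisenbergGL_mul (ξ η : ℂ) (t s : ℝ) :
    heisenbergGL ξ t * heisenbergGL η s =
      heisenbergGL (ξ + η) (t + s + 2 * (ξ * starRingEnd ℂ η).im) :=
  Units.ext (heisenbergPsi_mul ξ η t s)

theorem heisenbergGL_zero : heisenbergGL 0 0 = 1 :=
  Units.ext heisenbergPsi_zero

theorem heisenbergGL_inv (ξ : ℂ) (t : ℝ) : (heisenbergGL ξ t)⁻¹ = heisenbergGL (-ξ) (-t) :=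
  Units.ext rfl

theorem heisenbergGL_zpow (ξ : ℂ) (t : ℝ) (m : ℤ) :
    heisenbergGL ξ t ^ m = heisenbergGL (m * ξ) (m * t) := by
  have him (r : ℝ) : ((r : ℂ) * ξ * starRingEnd ℂ ξ).im = 0 := by
    rw [mul_assoc, Complex.mul_conj, ← ofReal_mul, ofReal_im]
  induction m using Int.induction_on with
  | zero => simp [heisenbergGL_zero]
  | succ n ih =>
    have h := him n
    push_cast at h ih ⊢
    rw [_root_.zpow_add_one, ih, heisenbergGL_mul, h]
    congr 1 <;> ring
  | pred n ih =>
    have h := him n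
    push_cast at h ih ⊢
    rw [_root_.zpow_sub_one, ih, heisenbergGL_inv, heisenbergGL_mul]
    congr 1
    · ring
    · simp only [map_neg, neg_mul, mul_neg, neg_neg, h]
      ring

theorem heisenbergPsi_eq_one {ξ : ℂ} {t : ℝ} (h : heisenbergPsi ξ t = 1) : ξ = 0 ∧ t = 0 := by
  have hξ : ξ = 0 := by simpa [heisenbergPsi] using congrFun (congrFun h 0) 1
  refine ⟨hξ, ?_⟩
  simpa [heisenbergPsi, hξ] using congrFun (congrFun h 2) 1

theorem heisenbergGL_eq_one {ξ : ℂ} {t : ℝ} (h : heisenbergGL ξ t = 1) : ξ = 0 ∧ t = 0 :=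
  heisenbergPsi_eq_one (congrArg Units.val h)

/-- If `c` is central for `a` and `b`, and `b a = c ^ k a b`, then every element of the subgroup
generated by `a`, `b`, `c` has the form `a ^ m * b ^ n * c ^ p`. -/
theorem exists_normal_form {G : Type*} [Group G] {a b c : G} {k : ℤ}
    (hba : b * a = c ^ k * a * b) (hca : Commute c a) (hcb : Commute c b)
    {x : G} (hx : x ∈ Subgroup.closure {a, b, c}) :
    ∃ m n p : ℤ, x = a ^ m * b ^ n * c ^ p := by
  have conj (m : ℤ) : b * a ^ m = a ^ m * b * c ^ (k * m) := by
    have h1 : b * a * b⁻¹ = c ^ k * a := by rw [hba]; group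
    have h2 : b * a ^ m * b⁻¹ = c ^ (k * m) * a ^ m := by
      rw [← conj_zpow, h1, (hca.zpow_left k).mul_zpow, _root_.zpow_mul]
    rw [mul_inv_eq_iff_eq_mul.mp h2, mul_assoc,
      ((hca.zpow_zpow (k * m) m).mul_right (hcb.zpow_left (k * m))).eq]
  have conj_inv (m : ℤ) : b⁻¹ * a ^ m = a ^ m * b⁻¹ * c ^ (-(k * m)) := by
    rw [_root_.zpow_neg, eq_mul_inv_iff_mul_eq, mul_assoc, inv_mul_eq_iff_eq_mul, ← mul_assoc, conj,
      mul_assoc (a ^ m * b), (hcb.inv_right.zpow_left (k * m)).eq, ← mul_assoc,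
      mul_inv_cancel_right]
  have central (q m n p : ℤ) : c ^ q * (a ^ m * b ^ n * c ^ p) = a ^ m * b ^ n * c ^ (q + p) := by
    rw [← mul_assoc, ((hca.zpow_zpow q m).mul_right (hcb.zpow_zpow q n)).eq, mul_assoc,
      ← _root_.zpow_add]
  have central_right (q n p : ℤ) : c ^ q * (b ^ n * c ^ p) = b ^ n * c ^ (q + p) := by
    simpa using central q 0 n p
  induction hx using Subgroup.closure_induction_left with
  | one => exact ⟨0, 0, 0, by simp⟩
  | mul_left y hy z _ ih =>
    obtain ⟨m, n, p, rfl⟩ := ih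
    rcases hy with rfl | rfl | rfl
    · exact ⟨m + 1, n, p, by rw [add_comm, _root_.zpow_one_add]; group⟩
    · refine ⟨m, n + 1, k * m + p, ?_⟩
      rw [mul_assoc, ← mul_assoc y, conj, mul_assoc _ (c ^ _), central_right, add_comm n,
        _root_.zpow_one_add]
      simp only [mul_assoc]
    · exact ⟨m, n, 1 + p, by simpa using central 1 m n p⟩
  | inv_mul_cancel y hy z _ ih =>
    obtain ⟨m, n, p, rfl⟩ := ih
    rcases hy with rfl | rfl | rfl
    · exact ⟨m - 1, n, p, by rw [sub_eq_neg_add, _root_.zpow_add, _root_.zpow_neg_one]; group⟩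
    · refine ⟨m, n - 1, -(k * m) + p, ?_⟩
      rw [mul_assoc, ← mul_assoc y⁻¹, conj_inv, mul_assoc _ (c ^ _), central_right,
        sub_eq_neg_add n, _root_.zpow_add _ (-1), _root_.zpow_neg_one]
      simp only [mul_assoc]
    · exact ⟨m, n, -1 + p, by simpa using central (-1) m n p⟩

/-- The images in `GL(3, ℂ)` of the generators of `Γ₁`. -/
noncomputable def gamma1Gens (k : ℕ) : Fin 3 → GL (Fin 3) ℂ :=
  ![heisenbergGL (2 * k) 0, heisenbergGL (2 * k * I) 0, heisenbergGL 0 (16 * k)]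

theorem lift_gamma1Gens_eq_one (k : ℕ) :
    ∀ r ∈ gamma1Rels k, FreeGroup.lift (gamma1Gens k) r = 1 := by
  rintro r (rfl | rfl | rfl)
  · simp only [map_mul, map_inv, map_pow, FreeGroup.lift_apply_of, gamma1Gens, Matrix.cons_val]
    rw [← zpow_natCast, heisenbergGL_zpow]
    simp only [heisenbergGL_inv, heisenbergGL_mul, ← heisenbergGL_zero]
    congr 1
    · ring
    · simp
      ring
  all_goals
    simp only [map_mul, map_inv, FreeGroup.lift_apply_of, gamma1Gens, Matrix.cons_val]
    simp only [heisenbergGL_inv, heisenbergGL_mul, ← heisenbergGL_zero]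
    congr 1
    · ring
    · simp

theorem gamma1_normal_form (k : ℕ) (x : PresentedGroup (gamma1Rels k)) :
    ∃ m n p : ℤ, x = PresentedGroup.of 0 ^ m * PresentedGroup.of 1 ^ n *
      PresentedGroup.of 2 ^ p := by
  have hr {r : FreeGroup (Fin 3)} (h : r ∈ gamma1Rels k) :
      PresentedGroup.mk (gamma1Rels k) r = 1 := PresentedGroup.one_of_mem h
  have h1 := hr (Or.inl rfl)
  have h2 := hr (Or.inr (Or.inl rfl))
  have h3 := hr (Or.inr (Or.inr rfl))
  simp only [map_mul, map_inv, map_pow] at h1 h2 h3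
  refine exists_normal_form (k := k) ?_ ?_ ?_ ?_
  · rw [zpow_natCast]
    exact mul_inv_eq_iff_eq_mul.mp (mul_inv_eq_iff_eq_mul.mp (mul_inv_eq_one.mp h1))
  · exact mul_inv_eq_iff_eq_mul.mp (mul_inv_eq_one.mp h2)
  · exact mul_inv_eq_iff_eq_mul.mp (mul_inv_eq_one.mp h3)
  · have hrange : Set.range (PresentedGroup.of (rels := gamma1Rels k)) =
        {PresentedGroup.of 0, PresentedGroup.of 1, PresentedGroup.of 2} := by
      ext y
      simp [Fin.exists_fin_succ, eq_comm]
    rw [← hrange, PresentedGroup.closure_range_of]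
    exact Subgroup.mem_top x

theorem heisenbergPsi_mem_closure_I {ξ v : ℂ} {t : ℝ} (hξ : ξ ∈ Subring.closure ({I} : Set ℂ))
    (hξ' : starRingEnd ℂ ξ ∈ Subring.closure ({I} : Set ℂ))
    (hv : v ∈ Subring.closure ({I} : Set ℂ)) (h : ((normSq ξ : ℂ) - t * I) / 2 = v)
    (i j : Fin 3) : heisenbergPsi ξ t i j ∈ Subring.closure ({I} : Set ℂ) := by
  have h1 : (1 : ℂ) ∈ Subring.closure ({I} : Set ℂ) := one_mem _
  fin_cases i <;> fin_cases j <;> simp only [heisenbergPsi, h] <;>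
    first
      | exact h1
      | exact hξ
      | exact hξ'
      | exact hv
      | exact neg_mem hξ'
      | exact neg_mem hv
      | exact sub_mem h1 hv
      | exact add_mem h1 hv

theorem stmt15 (k : ℕ) (hk : 0 < k) :
    ∃ φ : PresentedGroup (gamma1Rels k) →* GL (Fin 3) ℂ,
      Function.Injective φ ∧
      (φ (PresentedGroup.of 0) : Matrix (Fin 3) (Fin 3) ℂ) = heisenbergPsi (2 * k) 0 ∧
      (φ (PresentedGroup.of 1) : Matrix (Fin 3) (Fin 3) ℂ) = heisenbergPsi (2 * k * I) 0 ∧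
      (φ (PresentedGroup.of 2) : Matrix (Fin 3) (Fin 3) ℂ) = heisenbergPsi 0 (16 * k) ∧
      ∀ g : Fin 3, ∀ i j : Fin 3,
        (φ (PresentedGroup.of g) : Matrix (Fin 3) (Fin 3) ℂ) i j ∈
          Subring.closure ({I} : Set ℂ) := by
  set φ := PresentedGroup.toGroup (lift_gamma1Gens_eq_one k)
  have h0 : φ (PresentedGroup.of 0) = heisenbergGL (2 * k) 0 := PresentedGroup.toGroup.of _
  have h1 : φ (PresentedGroup.of 1) = heisenbergGL (2 * k * I) 0 := PresentedGroup.toGroup.of _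
  have h2 : φ (PresentedGroup.of 2) = heisenbergGL 0 (16 * k) := PresentedGroup.toGroup.of _
  have hI : I ∈ Subring.closure ({I} : Set ℂ) := Subring.subset_closure rfl
  have hnat (n : ℕ) : (n : ℂ) ∈ Subring.closure ({I} : Set ℂ) := natCast_mem _ n
  have h2k : (2 * k : ℂ) ∈ Subring.closure ({I} : Set ℂ) := mod_cast hnat (2 * k)
  have h2kk : (2 * k * k : ℂ) ∈ Subring.closure ({I} : Set ℂ) := mod_cast hnat (2 * k * k)
  have h8k : (8 * k : ℂ) ∈ Subring.closure ({I} : Set ℂ) := mod_cast hnat (8 * k)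
  refine ⟨φ, ?_, congrArg Units.val h0, congrArg Units.val h1, congrArg Units.val h2, ?_⟩
  · rw [injective_iff_map_eq_one]
    intro x hx
    obtain ⟨m, n, p, rfl⟩ := gamma1_normal_form k x
    simp only [map_mul, map_zpow, h0, h1, h2, heisenbergGL_zpow, heisenbergGL_mul] at hx
    obtain ⟨hξ, ht⟩ := heisenbergGL_eq_one hx
    have hk' : (k : ℝ) ≠ 0 := by positivity
    have hm : m = 0 := by simpa [hk'] using congrArg Complex.re hξ
    have hn : n = 0 := by simpa [hk'] using congrArg Complex.im hξ
    have hp : p = 0 := by simpa [hm, hn, hk'] using ht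
    simp [hm, hn, hp]
  · intro g
    fin_cases g
    · change ∀ i j, (φ (PresentedGroup.of 0)).val i j ∈ _
      rw [h0]
      refine heisenbergPsi_mem_closure_I h2k (by simpa [conj_ofNat] using h2k) h2kk ?_
      simp [normSq_apply]
      ring
    · change ∀ i j, (φ (PresentedGroup.of 1)).val i j ∈ _
      rw [h1]
      refine heisenbergPsi_mem_closure_I (mul_mem h2k hI)
        (by simpa [conj_ofNat] using mul_mem h2k hI) h2kk ?_
      simp [normSq_apply]
      ring
    · change ∀ i j, (φ (PresentedGroup.of 2)).val i j ∈ _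
      rw [h2]
      refine heisenbergPsi_mem_closure_I (zero_mem _) (by simp)
        (neg_mem (mul_mem h8k hI)) ?_
      simp
      ring
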